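/- (Theorem 1, STIP computational equivalence.) Consider an L-layer Transformer model F_θ that, on input x ∈ ℝ^{n×d}, applies L sequential post-LayerNorm Transformer layers f_1, …, f_L (each layer i with attention weights W_q^{(i)}, W_k^{(i)}, W_v^{(i)}, W_o^{(i)} ∈ ℝ^{d×d}, feedforward weights W₁^{(i)} ∈ ℝ^{d×m}, W₂^{(i)} ∈ ℝ^{m×d}, LayerNorm weights γ₁^{(i)}, β₁^{(i)}, γ₂^{(i)}, β₂^{(i)} ∈ ℝ^d, shared mask M ∈ ℝ^{n×n} and constant k > 0, computing u = SoftMax((xW_q)(xW_k)ᵀ/√k + M)(xW_v)W_o, v = LayerNorm(u + x; γ₁, β₁), z = ReLU(vW₁)W₂, y = LayerNorm(z + v; γ₂, β₂)), followed by a classifier o = SoftMax(y_L W_c) with W_c ∈ ℝ^{d×s}. Given a d×d permutation matrix π, an s×s permutation matrix π_c, and for each layer i two d×d permutation matrices π_{i,1}, π_{i,2} and one m×m permutation matrix π_{i,3}, define the transformed model F_{θ'} by replacing, in every layer i, W_q by πᵀW_qπ_{i,1}, W_k by πᵀW_kπ_{i,1}, W_v by πᵀW_vπ_{i,2}, W_o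 by π_{i,2}ᵀW_oπ, W₁ by πᵀW₁π_{i,3}, W₂ by π_{i,3}ᵀW₂π, each LayerNorm weight γ by γπ and β by βπ, and replacing W_c by πᵀW_cπ_c. Then for every input x ∈ ℝ^{n×d}, F_{θ'}(xπ)π_cᵀ = F_θ(x). -/

import Mathlib

open Matrix

noncomputable section

/-- The `d × d` real permutation matrix of a permutation `σ`, with `π i j = 1` iff `σ i = j`. -/
def permMatrix {d : ℕ} (σ : Equiv.Perm (Fin d)) : Matrix (Fin d) (Fin d) ℝ :=
  Matrix.of fun i j => if σ i = j then (1 : ℝ) else 0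

/-- Row-wise SoftMax: `SoftMax(z)_{ij} = exp(z_{ij}) / Σ_k exp(z_{ik})`. -/
def softmax {n m : ℕ} (z : Matrix (Fin n) (Fin m) ℝ) : Matrix (Fin n) (Fin m) ℝ :=
  Matrix.of fun i j => Real.exp (z i j) / ∑ k, Real.exp (z i k)

/-- Mean of row `i` of `x`: `μ_i = (1/d) Σ_j x_{ij}`. -/
def rowMean {n d : ℕ} (x : Matrix (Fin n) (Fin d) ℝ) (i : Fin n) : ℝ :=
  (∑ j, x i j) / d

/-- Standard deviation of row `i` of `x`: `σ_i = sqrt((1/d) Σ_j (x_{ij} − μ_i)²)`. -/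
def rowStd {n d : ℕ} (x : Matrix (Fin n) (Fin d) ℝ) (i : Fin n) : ℝ :=
  Real.sqrt ((∑ j, (x i j - rowMean x i) ^ 2) / d)

/-- LayerNorm with weights `γ, β`:
`LayerNorm(x; γ, β)_{ij} = γ_j · (x_{ij} − μ_i)/σ_i + β_j`. -/
def layerNorm {n d : ℕ} (x : Matrix (Fin n) (Fin d) ℝ) (γ β : Fin d → ℝ) :
    Matrix (Fin n) (Fin d) ℝ :=
  Matrix.of fun i j => γ j * ((x i j - rowMean x i) / rowStd x i) + β j

/-- ReLU applied entrywise to a matrix: `ReLU(t) = max(t, 0)`. -/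
def reluMat {n m : ℕ} (x : Matrix (Fin n) (Fin m) ℝ) : Matrix (Fin n) (Fin m) ℝ :=
  Matrix.of fun i j => max (x i j) 0

/-- A post-LayerNorm Transformer layer:
`u = SoftMax((xW_q)(xW_k)ᵀ/√k + M)(xW_v)W_o`, `v = LayerNorm(u + x; γ₁, β₁)`,
`z = ReLU(vW₁)W₂`, output `y = LayerNorm(z + v; γ₂, β₂)`. -/
def transformerLayer {n d m : ℕ}
    (Wq Wk Wv Wo : Matrix (Fin d) (Fin d) ℝ)
    (W₁ : Matrix (Fin d) (Fin m) ℝ) (W₂ : Matrix (Fin m) (Fin d) ℝ)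
    (γ₁ β₁ γ₂ β₂ : Fin d → ℝ)
    (M : Matrix (Fin n) (Fin n) ℝ) (k : ℝ)
    (x : Matrix (Fin n) (Fin d) ℝ) : Matrix (Fin n) (Fin d) ℝ :=
  let u := softmax ((Real.sqrt k)⁻¹ • ((x * Wq) * (x * Wk)ᵀ) + M) * (x * Wv) * Wo
  let v := layerNorm (u + x) γ₁ β₁
  let z := reluMat (v * W₁) * W₂
  layerNorm (z + v) γ₂ β₂

/-- The `L`-layer Transformer model `F_θ`: `L` sequential post-LayerNorm Transformer
layers followed by the classifier `o = SoftMax(y_L W_c)`. -/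
def transformerModel {n d m s : ℕ} (L : ℕ)
    (Wq Wk Wv Wo : Fin L → Matrix (Fin d) (Fin d) ℝ)
    (W₁ : Fin L → Matrix (Fin d) (Fin m) ℝ) (W₂ : Fin L → Matrix (Fin m) (Fin d) ℝ)
    (γ₁ β₁ γ₂ β₂ : Fin L → Fin d → ℝ)
    (M : Matrix (Fin n) (Fin n) ℝ) (k : ℝ)
    (Wc : Matrix (Fin d) (Fin s) ℝ)
    (x : Matrix (Fin n) (Fin d) ℝ) : Matrix (Fin n) (Fin s) ℝ :=
  softmax
    (((List.finRange L).foldl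
        (fun acc i =>
          transformerLayer (Wq i) (Wk i) (Wv i) (Wo i) (W₁ i) (W₂ i)
            (γ₁ i) (β₁ i) (γ₂ i) (β₂ i) M k acc)
        x) * Wc)

theorem mul_permMatrix {n d : ℕ} (x : Matrix (Fin n) (Fin d) ℝ) (σ : Equiv.Perm (Fin d)) :
    x * permMatrix σ = x.submatrix id σ.symm := by
  ext i j
  simp [permMatrix, Matrix.mul_apply, ← Equiv.eq_symm_apply]

theorem vecMul_permMatrix {d : ℕ} (v : Fin d → ℝ) (σ : Equiv.Perm (Fin d)) :
    v ᵥ* permMatrix σ = v ∘ σ.symm := by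
  ext j
  simp [permMatrix, Matrix.vecMul, dotProduct, ← Equiv.eq_symm_apply]

theorem permMatrix_mul_transpose {d : ℕ} (σ : Equiv.Perm (Fin d)) :
    permMatrix σ * (permMatrix σ)ᵀ = 1 := by
  ext i j
  simp [permMatrix, Matrix.mul_apply, Matrix.one_apply, eq_comm]

theorem mul_permMatrix_mul_transpose_mul {n d m : ℕ} (x : Matrix (Fin n) (Fin d) ℝ)
    (σ : Equiv.Perm (Fin d)) (W : Matrix (Fin d) (Fin m) ℝ) (τ : Equiv.Perm (Fin m)) :
    x * permMatrix σ * ((permMatrix σ)ᵀ * W * permMatrix τ) = x * W * permMatrix τ := by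
  rw [Matrix.mul_assoc (permMatrix σ)ᵀ, Matrix.mul_assoc x, ← Matrix.mul_assoc (permMatrix σ),
    permMatrix_mul_transpose, Matrix.one_mul, Matrix.mul_assoc]

theorem mul_permMatrix_mul_transpose_self {n m d : ℕ} (x : Matrix (Fin n) (Fin d) ℝ)
    (y : Matrix (Fin m) (Fin d) ℝ) (σ : Equiv.Perm (Fin d)) :
    x * permMatrix σ * (y * permMatrix σ)ᵀ = x * yᵀ := by
  rw [Matrix.transpose_mul, Matrix.mul_assoc, ← Matrix.mul_assoc (permMatrix σ),
    permMatrix_mul_transpose, Matrix.one_mul]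

theorem softmax_mul_permMatrix {n d : ℕ} (x : Matrix (Fin n) (Fin d) ℝ)
    (σ : Equiv.Perm (Fin d)) :
    softmax (x * permMatrix σ) = softmax x * permMatrix σ := by
  ext i j
  simp only [mul_permMatrix, softmax, Matrix.submatrix_apply, Matrix.of_apply, id]
  rw [Equiv.sum_comp σ.symm fun k => Real.exp (x i k)]

theorem reluMat_mul_permMatrix {n d : ℕ} (x : Matrix (Fin n) (Fin d) ℝ)
    (σ : Equiv.Perm (Fin d)) :
    reluMat (x * permMatrix σ) = reluMat x * permMatrix σ := by
  simp only [mul_permMatrix]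
  rfl

theorem rowMean_mul_permMatrix {n d : ℕ} (x : Matrix (Fin n) (Fin d) ℝ)
    (σ : Equiv.Perm (Fin d)) (i : Fin n) :
    rowMean (x * permMatrix σ) i = rowMean x i := by
  simp only [mul_permMatrix, rowMean, Matrix.submatrix_apply, id]
  rw [Equiv.sum_comp σ.symm (x i)]

theorem rowStd_mul_permMatrix {n d : ℕ} (x : Matrix (Fin n) (Fin d) ℝ)
    (σ : Equiv.Perm (Fin d)) (i : Fin n) :
    rowStd (x * permMatrix σ) i = rowStd x i := by
  simp only [rowStd, rowMean_mul_permMatrix]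
  simp only [mul_permMatrix, Matrix.submatrix_apply, id]
  rw [Equiv.sum_comp σ.symm fun j => (x i j - rowMean x i) ^ 2]

theorem layerNorm_mul_permMatrix {n d : ℕ} (x : Matrix (Fin n) (Fin d) ℝ) (γ β : Fin d → ℝ)
    (σ : Equiv.Perm (Fin d)) :
    layerNorm (x * permMatrix σ) (γ ᵥ* permMatrix σ) (β ᵥ* permMatrix σ) =
      layerNorm x γ β * permMatrix σ := by
  ext i j
  simp only [layerNorm, rowMean_mul_permMatrix, rowStd_mul_permMatrix]
  simp only [mul_permMatrix, vecMul_permMatrix, Matrix.submatrix_apply, Matrix.of_apply, id,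
    Function.comp_apply]

theorem transformerLayer_mul_permMatrix {n d m : ℕ}
    (Wq Wk Wv Wo : Matrix (Fin d) (Fin d) ℝ)
    (W₁ : Matrix (Fin d) (Fin m) ℝ) (W₂ : Matrix (Fin m) (Fin d) ℝ)
    (γ₁ β₁ γ₂ β₂ : Fin d → ℝ) (M : Matrix (Fin n) (Fin n) ℝ) (k : ℝ)
    (σ σ₁ σ₂ : Equiv.Perm (Fin d)) (σ₃ : Equiv.Perm (Fin m))
    (x : Matrix (Fin n) (Fin d) ℝ) :
    transformerLayer
        ((permMatrix σ)ᵀ * Wq * permMatrix σ₁) ((permMatrix σ)ᵀ * Wk * permMatrix σ₁)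
        ((permMatrix σ)ᵀ * Wv * permMatrix σ₂) ((permMatrix σ₂)ᵀ * Wo * permMatrix σ)
        ((permMatrix σ)ᵀ * W₁ * permMatrix σ₃) ((permMatrix σ₃)ᵀ * W₂ * permMatrix σ)
        (γ₁ ᵥ* permMatrix σ) (β₁ ᵥ* permMatrix σ) (γ₂ ᵥ* permMatrix σ) (β₂ ᵥ* permMatrix σ)
        M k (x * permMatrix σ) =
      transformerLayer Wq Wk Wv Wo W₁ W₂ γ₁ β₁ γ₂ β₂ M k x * permMatrix σ := by
  have attention (A : Matrix (Fin n) (Fin n) ℝ) :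
      A * (x * Wv * permMatrix σ₂) * ((permMatrix σ₂)ᵀ * Wo * permMatrix σ) =
        A * (x * Wv) * Wo * permMatrix σ := by
    rw [← Matrix.mul_assoc A, mul_permMatrix_mul_transpose_mul]
  simp only [transformerLayer, mul_permMatrix_mul_transpose_mul,
    mul_permMatrix_mul_transpose_self, attention, ← Matrix.add_mul, layerNorm_mul_permMatrix,
    reluMat_mul_permMatrix]

/-- Theorem 1 (STIP computational equivalence): `F_{θ'}(xπ)π_cᵀ = F_θ(x)`, where `θ'`
replaces in every layer `i` the weights `W_q, W_k, W_v, W_o, W₁, W₂` by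
`πᵀW_qπ_{i,1}, πᵀW_kπ_{i,1}, πᵀW_vπ_{i,2}, π_{i,2}ᵀW_oπ, πᵀW₁π_{i,3}, π_{i,3}ᵀW₂π`,
each LayerNorm weight `γ` by `γπ` and `β` by `βπ`, and `W_c` by `πᵀW_cπ_c`. -/
theorem stip_computational_equivalence {n d m s : ℕ} (L : ℕ)
    (Wq Wk Wv Wo : Fin L → Matrix (Fin d) (Fin d) ℝ)
    (W₁ : Fin L → Matrix (Fin d) (Fin m) ℝ) (W₂ : Fin L → Matrix (Fin m) (Fin d) ℝ)
    (γ₁ β₁ γ₂ β₂ : Fin L → Fin d → ℝ)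
    (M : Matrix (Fin n) (Fin n) ℝ) (k : ℝ) (hk : 0 < k)
    (Wc : Matrix (Fin d) (Fin s) ℝ)
    (σ : Equiv.Perm (Fin d)) (σc : Equiv.Perm (Fin s))
    (σ₁ σ₂ : Fin L → Equiv.Perm (Fin d)) (σ₃ : Fin L → Equiv.Perm (Fin m))
    (x : Matrix (Fin n) (Fin d) ℝ) :
    let π := permMatrix σ
    let πc := permMatrix σc
    transformerModel L
        (fun i => πᵀ * Wq i * permMatrix (σ₁ i))
        (fun i => πᵀ * Wk i * permMatrix (σ₁ i))
        (fun i => πᵀ * Wv i * permMatrix (σ₂ i))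
        (fun i => (permMatrix (σ₂ i))ᵀ * Wo i * π)
        (fun i => πᵀ * W₁ i * permMatrix (σ₃ i))
        (fun i => (permMatrix (σ₃ i))ᵀ * W₂ i * π)
        (fun i => γ₁ i ᵥ* π) (fun i => β₁ i ᵥ* π)
        (fun i => γ₂ i ᵥ* π) (fun i => β₂ i ᵥ* π)
        M k (πᵀ * Wc * πc) (x * π) * πcᵀ =
      transformerModel L Wq Wk Wv Wo W₁ W₂ γ₁ β₁ γ₂ β₂ M k Wc x := by
  intro π πc
  have layers (l : List (Fin L)) (y : Matrix (Fin n) (Fin d) ℝ) :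
      l.foldl (fun acc i =>
          transformerLayer (πᵀ * Wq i * permMatrix (σ₁ i)) (πᵀ * Wk i * permMatrix (σ₁ i))
            (πᵀ * Wv i * permMatrix (σ₂ i)) ((permMatrix (σ₂ i))ᵀ * Wo i * π)
            (πᵀ * W₁ i * permMatrix (σ₃ i)) ((permMatrix (σ₃ i))ᵀ * W₂ i * π)
            (γ₁ i ᵥ* π) (β₁ i ᵥ* π) (γ₂ i ᵥ* π) (β₂ i ᵥ* π) M k acc) (y * π) =
        l.foldl (fun acc i =>
          transformerLayer (Wq i) (Wk i) (Wv i) (Wo i) (W₁ i) (W₂ i)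
            (γ₁ i) (β₁ i) (γ₂ i) (β₂ i) M k acc) y * π :=
    (List.foldl_hom (· * π) fun z i => transformerLayer_mul_permMatrix (Wq i) (Wk i) (Wv i)
      (Wo i) (W₁ i) (W₂ i) (γ₁ i) (β₁ i) (γ₂ i) (β₂ i) M k σ (σ₁ i) (σ₂ i) (σ₃ i) z)
  rw [transformerModel, layers, mul_permMatrix_mul_transpose_mul, softmax_mul_permMatrix,
    Matrix.mul_assoc, permMatrix_mul_transpose, Matrix.mul_one, transformerModel]
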